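/- (Sharpness, core of Theorem 1(b)) Let 0 < p < 1/2 and assume λ = sup_k m_k < ∞. There exists a constant c_p > 0, depending only on p and λ, such that the following holds. Let n ∈ ℕ_+ with 1 ≤ ⟨n⟩ < |n|, set N = |n|, and define a_N = M_N^{1/p − 1} (D_{M_{N+1}} − D_{M_N}). Then sup_{t > 0} t^p · μ({x ∈ G_m : |σ_n a_N(x)| > t}) ≥ c_p · (M_{|n|} / M_{⟨n⟩})^{1 − 2p}. (Note that λ^{−1} a_N is a p-atom supported on I_N, so this weak-L_p lower bound blows up along any sequence (n_k) with |n_k| − ⟨n_k⟩ → ∞.) -/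

import Mathlib

open MeasureTheory Finset

noncomputable section

namespace Vilenkin

instance (n : ℕ) : MeasurableSpace (ZMod n) := ⊤

abbrev G (m : ℕ → ℕ) : Type := ∀ k, ZMod (m k)

def M (m : ℕ → ℕ) : ℕ → ℕ
  | 0 => 1
  | k + 1 => m k * M m k

def digit (m : ℕ → ℕ) (n k : ℕ) : ℕ := (n / M m k) % m k

def rad (m : ℕ → ℕ) (k : ℕ) (x : G m) : ℂ :=
  Complex.exp (2 * (Real.pi : ℂ) * Complex.I * ((x k).val : ℂ) / (m k : ℂ))

def psi (m : ℕ → ℕ) (n : ℕ) (x : G m) : ℂ :=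
  ∏ k ∈ Finset.range (n + 1), rad m k x ^ digit m n k

def D (m : ℕ → ℕ) (n : ℕ) (x : G m) : ℂ := ∑ k ∈ Finset.range n, psi m k x

def K (m : ℕ → ℕ) (n : ℕ) (x : G m) : ℂ := (n : ℂ)⁻¹ * ∑ k ∈ Finset.range n, D m k x

def cyl (m : ℕ → ℕ) (n : ℕ) (x : G m) : Set (G m) := {y | ∀ j < n, y j = x j}

def e (m : ℕ → ℕ) (k : ℕ) : G m := fun j => if j = k then 1 else 0

def lo (m : ℕ → ℕ) (n : ℕ) : ℕ := sInf {j | digit m n j ≠ 0}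

def hi (m : ℕ → ℕ) (n : ℕ) : ℕ := sSup {j | digit m n j ≠ 0}

def Iij (m : ℕ → ℕ) (N i j : ℕ) : Set (G m) :=
  if j = N then {x | x i ≠ 0 ∧ ∀ t < N, t ≠ i → x t = 0}
  else {x | (∀ t < i, x t = 0) ∧ x i ≠ 0 ∧ (∀ t, i < t → t < j → x t = 0) ∧ x j ≠ 0}

def IsVilenkinMeasure (m : ℕ → ℕ) (μ : Measure (G m)) : Prop :=
  IsProbabilityMeasure μ ∧ ∀ (n : ℕ) (x : G m), μ (cyl m n x) = (M m n : ENNReal)⁻¹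

def fhat (m : ℕ → ℕ) (μ : Measure (G m)) (f : G m → ℂ) (k : ℕ) : ℂ :=
  ∫ x, f x * (starRingEnd ℂ) (psi m k x) ∂μ

def S (m : ℕ → ℕ) (μ : Measure (G m)) (f : G m → ℂ) (n : ℕ) (x : G m) : ℂ :=
  ∑ k ∈ Finset.range n, fhat m μ f k * psi m k x

def sigma (m : ℕ → ℕ) (μ : Measure (G m)) (f : G m → ℂ) (n : ℕ) (x : G m) : ℂ :=
  (n : ℂ)⁻¹ * ∑ k ∈ Finset.range n, S m μ f k x

end Vilenkin

open Vilenkin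

namespace Vilenkin

variable {m : ℕ → ℕ}

theorem M_succ (k : ℕ) : M m (k + 1) = m k * M m k := rfl

theorem M_pos (hm : ∀ k, 2 ≤ m k) (k : ℕ) : 0 < M m k := by
  induction k with
  | zero => simp [M]
  | succ k ih => exact Nat.mul_pos (by linarith [hm k]) ih

theorem lt_M (hm : ∀ k, 2 ≤ m k) (k : ℕ) : k < M m k := by
  induction k with
  | zero => simp [M]
  | succ k ih =>
    rw [M_succ]
    nlinarith [hm k]

theorem M_dvd_M {j k : ℕ} (h : j ≤ k) : M m j ∣ M m k := by
  induction k, h using Nat.le_induction with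
  | base => exact dvd_rfl
  | succ k _ ih => exact ih.trans (Dvd.intro_left _ rfl)

theorem M_mono (hm : ∀ k, 2 ≤ m k) : Monotone (M m) := fun _ k h =>
  Nat.le_of_dvd (M_pos hm k) (M_dvd_M h)

theorem digit_eq_zero_of_lt (hm : ∀ k, 2 ≤ m k) {n R k : ℕ} (h : n < M m R) (hk : R ≤ k) :
    digit m n k = 0 := by
  rw [digit, Nat.div_eq_of_lt (h.trans_le (M_mono hm hk)), Nat.zero_mod]

theorem psi_eq_prod_range (hm : ∀ k, 2 ≤ m k) {n R : ℕ} (h : n < M m R) (x : G m) :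
    psi m n x = ∏ k ∈ range R, rad m k x ^ digit m n k := by
  have key : ∀ {P : ℕ}, n < M m P →
      ∏ k ∈ range P, rad m k x ^ digit m n k
        = ∏ k ∈ range (max R (n + 1)) ∪ range P, rad m k x ^ digit m n k := by
    intro P hP
    refine prod_subset subset_union_right fun k _ hk => ?_
    rw [digit_eq_zero_of_lt hm hP (by simpa using hk), pow_zero]
  have hn : n < M m (n + 1) := (Nat.lt_succ_self n).trans (lt_M hm _)
  rw [psi, key hn, key h, union_eq_left.2 (range_subset_range.2 (le_max_right _ _)),
    union_eq_left.2 (range_subset_range.2 (le_max_left _ _))]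

theorem mul_add_div_of_lt (a : ℕ) {b c : ℕ} (h : b < c) : (a * c + b) / c = a := by
  rw [Nat.add_comm, Nat.add_mul_div_right _ _ (by lia), Nat.div_eq_of_lt h, Nat.zero_add]

theorem digit_mul_add_of_lt (a : ℕ) {s k b : ℕ} (hm : ∀ k, 2 ≤ m k) (hk : k < s) :
    digit m (a * M m s + b) k = digit m b k := by
  obtain ⟨c, hc⟩ := M_dvd_M (m := m) (Nat.succ_le_of_lt hk)
  rw [digit, digit, hc, M_succ,
    show a * (m k * M m k * c) + b = b + m k * (a * c) * M m k by ring,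
    Nat.add_mul_div_right _ _ (M_pos hm k), Nat.add_mul_mod_self_left]

theorem digit_mul_add_of_le (a : ℕ) {s k b : ℕ} (hm : ∀ k, 2 ≤ m k) (hk : s ≤ k)
    (hb : b < M m s) : digit m (a * M m s + b) k = digit m (a * M m s) k := by
  obtain ⟨c, hc⟩ := M_dvd_M (m := m) hk
  have h := M_pos hm s
  rw [digit, digit, hc, ← Nat.div_div_eq_div_mul, ← Nat.div_div_eq_div_mul,
    mul_add_div_of_lt a hb, Nat.mul_div_cancel _ h]

theorem psi_mul_add (hm : ∀ k, 2 ≤ m k) (a : ℕ) {s b : ℕ} (hb : b < M m s) (x : G m) :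
    psi m (a * M m s + b) x = psi m (a * M m s) x * psi m b x := by
  have h := lt_M hm (a * M m s + b)
  rw [psi_eq_prod_range hm h, psi_eq_prod_range hm ((Nat.le_add_right _ _).trans_lt h),
    psi_eq_prod_range hm ((Nat.le_add_left _ _).trans_lt h), ← prod_mul_distrib]
  refine prod_congr rfl fun k _ => ?_
  rcases lt_or_ge k s with hk | hk
  · have h0 := digit_mul_add_of_lt a (b := 0) hm hk
    rw [digit_mul_add_of_lt a hm hk, ← add_zero (a * M m s), h0]
    simp [digit]
  · rw [digit_mul_add_of_le a hm hk hb, digit_eq_zero_of_lt hm hb hk, pow_zero, mul_one]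

theorem psi_mul_M (hm : ∀ k, 2 ≤ m k) {N c : ℕ} (hc : c < m N) (x : G m) :
    psi m (c * M m N) x = rad m N x ^ c := by
  have h : c * M m N < M m (N + 1) := by
    rw [M_succ]
    exact Nat.mul_lt_mul_of_pos_right hc (M_pos hm N)
  rw [psi_eq_prod_range hm h, prod_range_succ, prod_eq_one, one_mul, digit,
    Nat.mul_div_cancel _ (M_pos hm N), Nat.mod_eq_of_lt hc]
  intro k hk
  have h0 := digit_mul_add_of_lt c (b := 0) hm (mem_range.1 hk)
  rw [← add_zero (c * M m N), h0]
  simp [digit]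

theorem psi_M_add (hm : ∀ k, 2 ≤ m k) {N j : ℕ} (h : M m N + j < M m (N + 1)) (x : G m) :
    psi m (M m N + j) x = rad m N x * psi m j x := by
  have hb := Nat.mod_lt j (M_pos hm N)
  have hj := Nat.div_add_mod' j (M m N)
  have hc : j / M m N + 1 < m N := by
    rw [M_succ] at h
    by_contra! hlt
    have := Nat.mul_le_mul_right (M m N) hlt
    rw [Nat.succ_mul] at this
    lia
  rw [← hj, ← add_assoc, show M m N + j / M m N * M m N = (j / M m N + 1) * M m N by ring,
    psi_mul_add hm _ hb, psi_mul_add hm _ hb, psi_mul_M hm hc, psi_mul_M hm (by lia), pow_succ]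
  ring

theorem D_mul_M_add (hm : ∀ k, 2 ≤ m k) (a : ℕ) {s b : ℕ} (hb : b ≤ M m s) (x : G m) :
    D m (a * M m s + b) x = D m (a * M m s) x + psi m (a * M m s) x * D m b x := by
  simp only [D, sum_range_add, mul_sum]
  congr 1
  exact sum_congr rfl fun j hj => psi_mul_add hm a ((mem_range.1 hj).trans_le hb) x

theorem D_mul_M (hm : ∀ k, 2 ≤ m k) (a s : ℕ) (x : G m) :
    D m (a * M m s) x = (∑ j ∈ range a, psi m (j * M m s) x) * D m (M m s) x := by
  induction a with
  | zero => simp [D]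
  | succ a ih => rw [Nat.succ_mul, D_mul_M_add hm a le_rfl, ih, sum_range_succ, add_mul]

theorem rad_eq_pow (k : ℕ) (x : G m) :
    rad m k x = Complex.exp (2 * (Real.pi : ℂ) * Complex.I / (m k : ℂ)) ^ (x k).val := by
  rw [rad, ← Complex.exp_nat_mul]
  congr 1
  ring

theorem rad_eq_one {k : ℕ} {x : G m} (h : x k = 0) : rad m k x = 1 := by
  simp [rad_eq_pow, h]

theorem isPrimitiveRoot_rad (hm : ∀ k, 2 ≤ m k) {k : ℕ} {x : G m} (h : x k = 1) :
    IsPrimitiveRoot (rad m k x) (m k) := by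
  have : Fact (1 < m k) := ⟨hm k⟩
  rw [rad_eq_pow, h, ZMod.val_one, pow_one]
  exact Complex.isPrimitiveRoot_exp _ (by have := hm k; lia)

theorem geom_sum_eq_zero_of_pow_eq_one {z : ℂ} {k : ℕ} (hz : z ^ k = 1) (h1 : z ≠ 1) :
    ∑ c ∈ range k, z ^ c = 0 := by
  rw [geom_sum_eq h1, hz, sub_self, zero_div]

theorem geom_sum_rad (hm : ∀ k, 2 ≤ m k) {k : ℕ} {x : G m} (h : x k ≠ 0) :
    ∑ c ∈ range (m k), rad m k x ^ c = 0 := by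
  have hk : m k ≠ 0 := by have := hm k; lia
  have : NeZero (m k) := ⟨hk⟩
  have hp := Complex.isPrimitiveRoot_exp _ hk
  rw [rad_eq_pow]
  refine geom_sum_eq_zero_of_pow_eq_one ?_ ?_
  · rw [← pow_mul, mul_comm (x k).val, pow_mul, hp.pow_eq_one, one_pow]
  · exact hp.pow_ne_one_of_pos_of_lt (by simpa using h) (ZMod.val_lt _)

theorem psi_eq_one (hm : ∀ k, 2 ≤ m k) {N b : ℕ} (hb : b < M m N) {x : G m}
    (hx : x ∈ cyl m N 0) : psi m b x = 1 := by
  rw [psi_eq_prod_range hm hb]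
  refine prod_eq_one fun k hk => ?_
  rw [rad_eq_one (hx k (mem_range.1 hk)), one_pow]

theorem D_eq_natCast (hm : ∀ k, 2 ≤ m k) {N b : ℕ} (hb : b ≤ M m N) {x : G m}
    (hx : x ∈ cyl m N 0) : D m b x = b := by
  rw [D, sum_congr rfl fun j hj => psi_eq_one hm ((mem_range.1 hj).trans_le hb) hx]
  simp

theorem D_M_eq_zero (hm : ∀ k, 2 ≤ m k) {N k : ℕ} (hk : k < N) {x : G m} (hx : x k ≠ 0) :
    D m (M m N) x = 0 := by
  obtain ⟨c, hc⟩ := M_dvd_M (m := m) (Nat.succ_le_of_lt hk)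
  have h : D m (M m (k + 1)) x = 0 := by
    rw [M_succ, D_mul_M hm, sum_congr rfl fun c hc => psi_mul_M hm (mem_range.1 hc) x,
      geom_sum_rad hm hx, zero_mul]
  rw [hc, mul_comm, D_mul_M hm, h, mul_zero]

theorem D_M_eq_indicator (hm : ∀ k, 2 ≤ m k) (N : ℕ) (x : G m) :
    D m (M m N) x = (M m N : ℂ) * (cyl m N 0).indicator 1 x := by
  by_cases hx : x ∈ cyl m N 0
  · rw [D_eq_natCast hm le_rfl hx, Set.indicator_of_mem hx, Pi.one_apply, mul_one]
  · rw [Set.indicator_of_notMem hx, mul_zero]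
    simp only [cyl, Set.mem_ofPred_eq, not_forall] at hx
    obtain ⟨k, hk, hxk⟩ := hx
    exact D_M_eq_zero hm hk hxk

theorem sum_psi_mul_M (hm : ∀ k, 2 ≤ m k) {s : ℕ} {x : G m} (hx : x s ≠ 0) (A : ℕ) :
    ∃ j, ∑ a ∈ range A, psi m (a * M m s) x
      = psi m j x * ∑ c ∈ range (A % m s), rad m s x ^ c := by
  have hterm : ∀ B, ∀ c < m s, psi m ((B * m s + c) * M m s) x
      = psi m (B * M m (s + 1)) x * rad m s x ^ c := by
    intro B c hc
    rw [← psi_mul_M hm hc, ← psi_mul_add hm]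
    · rw [M_succ]
      ring_nf
    · rw [M_succ]
      exact Nat.mul_lt_mul_of_pos_right hc (M_pos hm s)
  have hblock : ∀ B, ∑ a ∈ range (B * m s), psi m (a * M m s) x = 0 := by
    intro B
    induction B with
    | zero => simp
    | succ B ih =>
      rw [Nat.succ_mul, sum_range_add, ih, zero_add,
        sum_congr rfl fun c hc => hterm B c (mem_range.1 hc), ← mul_sum, geom_sum_rad hm hx,
        mul_zero]
  have hlt := Nat.mod_lt A (show 0 < m s by have := hm s; lia)
  refine ⟨A / m s * M m (s + 1), ?_⟩
  conv_lhs => rw [← Nat.div_add_mod' A (m s)]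
  rw [sum_range_add, hblock, zero_add, mul_sum]
  exact sum_congr rfl fun c hc => hterm _ c ((mem_range.1 hc).trans hlt)

theorem norm_rad (k : ℕ) (x : G m) : ‖rad m k x‖ = 1 := by
  rw [rad, show 2 * (Real.pi : ℂ) * Complex.I * ((x k).val : ℂ) / (m k : ℂ)
    = ((2 * Real.pi * (x k).val / m k : ℝ) : ℂ) * Complex.I by push_cast; ring]
  exact Complex.norm_exp_ofReal_mul_I _

theorem norm_psi (n : ℕ) (x : G m) : ‖psi m n x‖ = 1 := by
  simp [psi, norm_prod, norm_rad]

theorem sum_D_mul_M (hm : ∀ k, 2 ≤ m k) {s : ℕ} {x : G m} (h : D m (M m s) x = 0) (A : ℕ) :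
    ∑ k ∈ range (A * M m s), D m k x
      = (∑ a ∈ range A, psi m (a * M m s) x) * ∑ b ∈ range (M m s), D m b x := by
  induction A with
  | zero => simp
  | succ A ih =>
    rw [Nat.succ_mul, sum_range_add, ih, sum_range_succ, add_mul,
      mul_sum _ _ (psi m (A * M m s) x)]
    congr 1
    refine sum_congr rfl fun b hb => ?_
    rw [D_mul_M_add hm A (mem_range.1 hb).le, D_mul_M hm, h, mul_zero, zero_add]

theorem one_sub_rad_mul_sum_D (hm : ∀ k, 2 ≤ m k) {u : ℕ} {x : G m} (hx : x ∈ cyl m u 0)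
    (hxu : x u ≠ 0) :
    (1 - rad m u x) * ∑ k ∈ range (M m (u + 1)), D m k x = (M m u : ℂ) * M m (u + 1) := by
  have key : ∀ c ≤ m u, (1 - rad m u x) * ∑ k ∈ range (c * M m u), D m k x
      = (c : ℂ) * (M m u) ^ 2 + (∑ j ∈ range c, rad m u x ^ j) *
        ((1 - rad m u x) * (∑ d ∈ range (M m u), (d : ℂ)) - (M m u) ^ 2) := by
    intro c
    induction c with
    | zero => simp
    | succ c ih =>
      intro hc
      have hD : ∀ d ∈ range (M m u), D m (c * M m u + d) x
          = (∑ j ∈ range c, rad m u x ^ j) * M m u + rad m u x ^ c * d := by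
        intro d hd
        rw [D_mul_M_add hm c (mem_range.1 hd).le, D_mul_M hm, D_eq_natCast hm le_rfl hx,
          D_eq_natCast hm (mem_range.1 hd).le hx, psi_mul_M hm hc,
          sum_congr rfl fun j hj => psi_mul_M hm ((mem_range.1 hj).trans hc) x]
      rw [Nat.succ_mul, sum_range_add, mul_add, ih (by lia), sum_congr rfl hD,
        sum_add_distrib, ← mul_sum _ _ (rad m u x ^ c), sum_const, card_range, nsmul_eq_mul, sum_range_succ]
      push_cast
      linear_combination (M m u : ℂ) ^ 2 * mul_neg_geom_sum (rad m u x) c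
  rw [M_succ, key _ le_rfl, geom_sum_rad hm hxu]
  push_cast
  ring

theorem one_le_mul_norm_one_sub {z : ℂ} {k : ℕ} (hk : 0 < k) (hz : z ^ k = 1) (h1 : z ≠ 1) :
    1 ≤ k * ‖1 - z‖ := by
  have hz1 : ‖z‖ = 1 := Complex.norm_eq_one_of_pow_eq_one hz hk.ne'
  have hj : ∀ j : ℕ, ‖1 - z ^ j‖ ≤ j * ‖1 - z‖ := by
    intro j
    rw [← mul_neg_geom_sum, norm_mul, mul_comm]
    refine mul_le_mul_of_nonneg_right ((norm_sum_le _ _).trans ?_) (norm_nonneg _)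
    simp [hz1]
  have hsum : ∑ j ∈ range k, (1 - z ^ j) = k := by
    rw [sum_sub_distrib, geom_sum_eq_zero_of_pow_eq_one hz h1]
    simp
  have hle : (k : ℝ) ≤ k * (k * ‖1 - z‖) := by
    calc (k : ℝ) = ‖∑ j ∈ range k, (1 - z ^ j)‖ := by simp [hsum]
      _ ≤ ∑ j ∈ range k, ‖1 - z ^ j‖ := norm_sum_le _ _
      _ ≤ ∑ _j ∈ range k, k * ‖1 - z‖ := by
        refine sum_le_sum fun j hj' => (hj j).trans ?_
        have : (j : ℝ) ≤ k := by exact_mod_cast (mem_range.1 hj').le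
        gcongr
      _ = k * (k * ‖1 - z‖) := by simp
  have : (0 : ℝ) < k := by exact_mod_cast hk
  exact le_of_mul_le_mul_left (by linarith) this

theorem norm_one_sub_le_two {z : ℂ} (hz : ‖z‖ = 1) : ‖1 - z‖ ≤ 2 := by
  refine (norm_sub_le _ _).trans ?_
  rw [hz, norm_one]
  norm_num

theorem norm_sum_D_ge (hm : ∀ k, 2 ≤ m k) {u A : ℕ} (hA : A % m (u + 1) ≠ 0) {x : G m}
    (hx : x ∈ cyl m u 0) (hxu : x u ≠ 0) (hxs : x (u + 1) = 1) :
    (M m u : ℝ) * M m (u + 1)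
      ≤ 4 * m (u + 1) * ‖∑ k ∈ range (A * M m (u + 1)), D m k x‖ := by
  have hs0 : 0 < m (u + 1) := by have := hm (u + 1); lia
  have hprim := isPrimitiveRoot_rad hm hxs
  have hxs' : x (u + 1) ≠ 0 := by
    intro h
    have := hprim.ne_one (hm (u + 1))
    exact this (rad_eq_one h)
  obtain ⟨j, hj⟩ := sum_psi_mul_M hm hxs' A
  rw [sum_D_mul_M hm (D_M_eq_zero hm (Nat.lt_succ_self u) hxu), hj, norm_mul, norm_mul, norm_psi,
    one_mul]
  set w := rad m (u + 1) x
  set a := A % m (u + 1)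
  set E := ∑ c ∈ range a, w ^ c
  set T := ∑ b ∈ range (M m (u + 1)), D m b x
  have hE : 1 ≤ m (u + 1) * (2 * ‖E‖) := by
    refine (one_le_mul_norm_one_sub hs0 (z := w ^ a) ?_ ?_).trans ?_
    · rw [← pow_mul, mul_comm a, pow_mul, hprim.pow_eq_one, one_pow]
    · exact hprim.pow_ne_one_of_pos_of_lt hA (Nat.mod_lt _ hs0)
    · rw [← mul_neg_geom_sum, norm_mul]
      gcongr (m (u + 1) : ℝ) * (?_ * _)
      exact norm_one_sub_le_two (norm_rad _ _)
  have hT : (M m u : ℝ) * M m (u + 1) ≤ 2 * ‖T‖ := by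
    have := congrArg norm (one_sub_rad_mul_sum_D hm hx hxu)
    rw [norm_mul, norm_mul, Complex.norm_natCast, Complex.norm_natCast] at this
    rw [← this]
    gcongr
    exact norm_one_sub_le_two (norm_rad _ _)
  nlinarith [norm_nonneg T]

theorem measurableSet_cyl (n : ℕ) (x : G m) : MeasurableSet (cyl m n x) := by
  have h : cyl m n x = ⋂ j ∈ Set.Iio n, (fun y : G m => y j) ⁻¹' {x j} := by
    ext y
    simp [cyl]
  rw [h]
  exact MeasurableSet.biInter (Set.to_countable _) fun j _ =>
    measurable_pi_apply j (MeasurableSpace.measurableSet_top)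

theorem mem_cyl_succ_update {N : ℕ} {a : ZMod (m N)} {x : G m} :
    x ∈ cyl m (N + 1) (Function.update 0 N a) ↔ x ∈ cyl m N 0 ∧ x N = a := by
  constructor
  · intro h
    refine ⟨fun j hj => ?_, ?_⟩
    · rw [h j (by lia), Function.update_of_ne hj.ne]
    · rw [h N (by lia), Function.update_self]
  · rintro ⟨h, rfl⟩ j hj
    rcases eq_or_ne j N with rfl | hne
    · rw [Function.update_self]
    · rw [h j (by lia), Function.update_of_ne hne]

theorem indicator_mul_conj_psi (hm : ∀ k, 2 ≤ m k) {N c b : ℕ} (hc : c < m N) (hb : b < M m N)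
    (x : G m) :
    (cyl m N 0).indicator 1 x * (starRingEnd ℂ) (psi m (c * M m N + b) x)
      = ∑ v ∈ range (m N),
        ((starRingEnd ℂ) (Complex.exp (2 * (Real.pi : ℂ) * Complex.I / (m N : ℂ))) ^ c) ^ v
          * (cyl m (N + 1) (Function.update 0 N (v : ZMod (m N)))).indicator 1 x := by
  have : NeZero (m N) := ⟨by lia⟩
  by_cases hx : x ∈ cyl m N 0
  · rw [sum_eq_single (x N).val]
    · rw [Set.indicator_of_mem hx,
        Set.indicator_of_mem (mem_cyl_succ_update.2 ⟨hx, (ZMod.natCast_zmod_val _).symm⟩),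
        psi_mul_add hm c hb, psi_mul_M hm hc, psi_eq_one hm hb hx, rad_eq_pow, pow_right_comm]
      simp
    · intro v hv hne
      rw [Set.indicator_of_notMem, mul_zero]
      intro h
      refine hne ?_
      rw [(mem_cyl_succ_update.1 h).2, ZMod.val_cast_of_lt (mem_range.1 hv)]
    · intro h
      exact absurd (mem_range.2 (ZMod.val_lt (x N))) h
  · rw [Set.indicator_of_notMem hx, zero_mul]
    refine (sum_eq_zero fun v _ => ?_).symm
    rw [Set.indicator_of_notMem fun h => hx (mem_cyl_succ_update.1 h).1, mul_zero]

theorem integrable_cyl {μ : Measure (G m)} (hμ : IsVilenkinMeasure m μ) (n : ℕ) (y : G m) :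
    Integrable ((cyl m n y).indicator (1 : G m → ℂ)) μ := by
  have := hμ.1
  exact (integrable_const (1 : ℂ)).indicator (measurableSet_cyl n y)

theorem integral_cyl {μ : Measure (G m)} (hμ : IsVilenkinMeasure m μ) (n : ℕ) (y : G m) :
    ∫ x, (cyl m n y).indicator (1 : G m → ℂ) x ∂μ = (M m n : ℂ)⁻¹ := by
  rw [integral_indicator (measurableSet_cyl n y)]
  simp [Measure.real, hμ.2]

theorem integrable_indicator_mul_conj_psi (hm : ∀ k, 2 ≤ m k) {μ : Measure (G m)}
    (hμ : IsVilenkinMeasure m μ) {N k : ℕ} (hk : k < M m (N + 1)) :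
    Integrable (fun x => (cyl m N 0).indicator 1 x * (starRingEnd ℂ) (psi m k x)) μ := by
  rw [← Nat.div_add_mod' k (M m N)]
  simp_rw [indicator_mul_conj_psi hm (Nat.div_lt_of_lt_mul (by rwa [mul_comm]))
    (Nat.mod_lt k (M_pos hm N))]
  exact integrable_finsetSum _ fun v _ => (integrable_cyl hμ _ _).const_mul _

theorem integral_indicator_mul_conj_psi (hm : ∀ k, 2 ≤ m k) {μ : Measure (G m)}
    (hμ : IsVilenkinMeasure m μ) {N k : ℕ} (hk : k < M m (N + 1)) :
    (M m N : ℂ) * ∫ x, (cyl m N 0).indicator 1 x * (starRingEnd ℂ) (psi m k x) ∂μ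
      = if k < M m N then 1 else 0 := by
  have hN : m N ≠ 0 := by have := hm N; lia
  have hM := M_pos hm N
  have hk' : k / M m N < m N := Nat.div_lt_of_lt_mul (by rwa [mul_comm])
  conv_lhs => rw [← Nat.div_add_mod' k (M m N)]
  simp_rw [indicator_mul_conj_psi hm hk' (Nat.mod_lt k hM)]
  rw [integral_finsetSum _ fun v _ => (integrable_cyl hμ _ _).const_mul _]
  simp_rw [integral_const_mul, integral_cyl hμ]
  rw [← sum_mul]
  split_ifs with h
  · have : (m N : ℂ) ≠ 0 := by exact_mod_cast hN
    have : (M m N : ℂ) ≠ 0 := by exact_mod_cast hM.ne'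
    rw [Nat.div_eq_of_lt h, M_succ]
    simp only [pow_zero, one_pow, sum_const, card_range, nsmul_eq_mul, mul_one]
    push_cast
    field_simp
  · have hp := Complex.isPrimitiveRoot_exp _ hN
    have hd : k / M m N ≠ 0 := (Nat.div_pos (not_lt.1 h) hM).ne'
    rw [geom_sum_eq_zero_of_pow_eq_one, zero_mul, mul_zero]
    · rw [← pow_mul, mul_comm (k / M m N), pow_mul, ← map_pow, hp.pow_eq_one, map_one, one_pow]
    · rw [← map_pow]
      intro h1
      refine hp.pow_ne_one_of_pos_of_lt hd hk' ?_
      simpa using congrArg (starRingEnd ℂ) h1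

theorem fhat_D_sub_D (hm : ∀ k, 2 ≤ m k) {μ : Measure (G m)} (hμ : IsVilenkinMeasure m μ)
    (C : ℂ) {N k : ℕ} (hk : k < M m (N + 1)) :
    fhat m μ (fun y => C * (D m (M m (N + 1)) y - D m (M m N) y)) k
      = if k < M m N then 0 else C := by
  have hk2 : k < M m (N + 1 + 1) := hk.trans_le (M_mono hm (Nat.le_succ _))
  have h : ∀ x : G m, C * (D m (M m (N + 1)) x - D m (M m N) x) * (starRingEnd ℂ) (psi m k x)
      = C * ((M m (N + 1) : ℂ) *
          ((cyl m (N + 1) 0).indicator 1 x * (starRingEnd ℂ) (psi m k x))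
        - (M m N : ℂ) * ((cyl m N 0).indicator 1 x * (starRingEnd ℂ) (psi m k x))) := by
    intro x
    rw [D_M_eq_indicator hm, D_M_eq_indicator hm]
    ring
  simp_rw [fhat, h]
  rw [integral_const_mul,
    integral_sub ((integrable_indicator_mul_conj_psi hm hμ hk2).const_mul _)
      ((integrable_indicator_mul_conj_psi hm hμ hk).const_mul _),
    integral_const_mul, integral_const_mul, integral_indicator_mul_conj_psi hm hμ hk2,
    integral_indicator_mul_conj_psi hm hμ hk, if_pos hk]
  split_ifs <;> simp

theorem S_D_sub_D (hm : ∀ k, 2 ≤ m k) {μ : Measure (G m)} (hμ : IsVilenkinMeasure m μ)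
    (C : ℂ) {N i : ℕ} (hi : M m N + i ≤ M m (N + 1)) (x : G m) :
    S m μ (fun y => C * (D m (M m (N + 1)) y - D m (M m N) y)) (M m N + i) x
      = C * (rad m N x * D m i x) := by
  rw [S, sum_range_add, sum_eq_zero, zero_add, D, mul_sum, mul_sum]
  · refine sum_congr rfl fun j hj => ?_
    have hj' : M m N + j < M m (N + 1) := by
      have := mem_range.1 hj
      lia
    rw [fhat_D_sub_D hm hμ C hj', if_neg (by lia), psi_M_add hm hj']
  · intro k hk
    have hk := mem_range.1 hk
    rw [fhat_D_sub_D hm hμ C (by lia), if_pos hk, zero_mul]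

theorem S_D_sub_D_of_le (hm : ∀ k, 2 ≤ m k) {μ : Measure (G m)} (hμ : IsVilenkinMeasure m μ)
    (C : ℂ) {N k : ℕ} (hk : k ≤ M m N) (x : G m) :
    S m μ (fun y => C * (D m (M m (N + 1)) y - D m (M m N) y)) k x = 0 := by
  refine sum_eq_zero fun j hj => ?_
  have hj := (mem_range.1 hj).trans_le hk
  rw [fhat_D_sub_D hm hμ C (hj.trans_le (M_mono hm (Nat.le_succ _))), if_pos hj, zero_mul]

theorem norm_sigma_D_sub_D (hm : ∀ k, 2 ≤ m k) {μ : Measure (G m)}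
    (hμ : IsVilenkinMeasure m μ) (C : ℂ) {N q : ℕ} (hq : M m N + q ≤ M m (N + 1)) (x : G m) :
    ‖sigma m μ (fun y => C * (D m (M m (N + 1)) y - D m (M m N) y)) (M m N + q) x‖
      = ‖C‖ * ‖∑ i ∈ range q, D m i x‖ / (M m N + q : ℕ) := by
  rw [sigma, sum_range_add,
    sum_eq_zero fun k hk => S_D_sub_D_of_le hm hμ C (mem_range.1 hk).le x, zero_add,
    sum_congr rfl fun i hi => S_D_sub_D hm hμ C (by have := mem_range.1 hi; lia) x,
    ← mul_sum, ← mul_sum]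
  simp only [norm_mul, norm_inv, Complex.norm_natCast, norm_rad, one_mul]
  rw [div_eq_inv_mul]

theorem digit_hi_ne_zero (hm : ∀ k, 2 ≤ m k) {n : ℕ} (h : 0 < hi m n) :
    digit m n (hi m n) ≠ 0 ∧ n < M m (hi m n + 1) := by
  have hb : BddAbove {j | digit m n j ≠ 0} := by
    refine ⟨n, fun j hj => ?_⟩
    by_contra! hlt
    exact hj (digit_eq_zero_of_lt hm (lt_M hm n) hlt.le)
  have hne : {j | digit m n j ≠ 0}.Nonempty := by
    by_contra! he
    simp [hi, he] at h
  refine ⟨Nat.sSup_mem hne hb, ?_⟩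
  have hz : ∀ j, hi m n < j → digit m n j = 0 := by
    intro j hj
    by_contra hd
    exact absurd (le_csSup hb hd) (not_le.2 hj)
  have key : ∀ i, n / M m (hi m n + 1 + i) = 0 → n / M m (hi m n + 1) = 0 := by
    intro i
    induction i with
    | zero => exact id
    | succ i ih =>
      intro h
      apply ih
      have hd := hz (hi m n + 1 + i) (by lia)
      rw [digit] at hd
      rw [← Nat.div_add_mod (n / M m (hi m n + 1 + i)) (m (hi m n + 1 + i)), hd,
        Nat.div_div_eq_div_mul, mul_comm (M m _), ← M_succ]
      simp only [Nat.add_assoc] at h ⊢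
      rw [h]
      simp
  have := key n (Nat.div_eq_of_lt ((lt_M hm n).trans_le (M_mono hm (by lia))))
  exact (Nat.div_eq_zero_iff_lt (M_pos hm _)).1 this

theorem M_dvd_of_le_lo {n j : ℕ} (h : j ≤ lo m n) : M m j ∣ n := by
  induction j with
  | zero => exact one_dvd _
  | succ j ih =>
    obtain ⟨a, ha⟩ := ih (by lia)
    have hd : digit m n j = 0 := by
      by_contra hd
      exact absurd (Nat.sInf_le (s := {j | digit m n j ≠ 0}) hd) (not_le.2 h)
    rcases Nat.eq_zero_or_pos (M m j) with h0 | h0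
    · simp [ha, h0]
    rw [digit, ha, Nat.mul_div_cancel_left _ h0] at hd
    rw [ha, M_succ, mul_comm]
    exact mul_dvd_mul_left _ (Nat.dvd_of_mod_eq_zero hd)

theorem exists_eq_M_hi_add (hm : ∀ k, 2 ≤ m k) {n : ℕ} (h : lo m n < hi m n) :
    ∃ A, n = M m (hi m n) + A * M m (lo m n) ∧ A % m (lo m n) ≠ 0 := by
  obtain ⟨hd, -⟩ := digit_hi_ne_zero hm ((Nat.zero_le _).trans_lt h)
  have hlo : digit m n (lo m n) ≠ 0 :=
    Nat.sInf_mem (s := {j | digit m n j ≠ 0}) ⟨_, hd⟩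
  have hle : M m (hi m n) ≤ n := by
    by_contra! hlt
    exact hd (digit_eq_zero_of_lt hm hlt le_rfl)
  obtain ⟨a, ha⟩ := M_dvd_of_le_lo (m := m) (le_refl (lo m n))
  obtain ⟨b, hb⟩ := M_dvd_M (m := m) (Nat.succ_le_of_lt h)
  have h0 := M_pos hm (lo m n)
  rw [digit] at hlo
  generalize lo m n = s at *
  generalize hi m n = N at *
  rw [M_succ] at hb
  have hba : m s * b ≤ a := by
    by_contra! hlt
    have := Nat.mul_lt_mul_of_pos_right hlt h0
    nlinarith
  refine ⟨a - m s * b, ?_, ?_⟩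
  · rw [hb, ha, Nat.sub_mul]
    have := Nat.mul_le_mul_right (M m s) hba
    nlinarith [Nat.sub_add_cancel this]
  · rw [Nat.sub_mul_mod hba]
    rwa [ha, Nat.mul_div_cancel_left _ h0] at hlo

theorem rpow_mul_inv_eq {p R s K : ℝ} (hp : 0 < p) (hR : 0 < R) (hs : 0 < s) (hK : 0 < K) :
    (R ^ (1 / p - 1) * s ^ 2 / (K * R)) ^ p * s⁻¹ = K ^ (-p) * (R / s) ^ (1 - 2 * p) := by
  have h1 : (R ^ (1 / p - 1)) ^ p = R ^ (1 - p) := by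
    rw [← Real.rpow_mul hR.le]
    congr 1
    field_simp
  have h2 : (s ^ 2) ^ p = s ^ (2 * p) := by
    rw [← Real.rpow_natCast, ← Real.rpow_mul hs.le]
    norm_num
  have h3 : R ^ (1 - 2 * p) = R ^ (1 - p) / R ^ p := by
    rw [← Real.rpow_sub hR]
    ring_nf
  have h4 : s ^ (1 - 2 * p) = s / s ^ (2 * p) := by
    rw [Real.rpow_sub hs, Real.rpow_one]
  rw [Real.div_rpow (by positivity) (by positivity), Real.mul_rpow (by positivity) (by positivity),
    Real.mul_rpow hK.le hR.le, h1, h2, Real.div_rpow hR.le hs.le, Real.rpow_neg hK.le, h3, h4]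
  field_simp

end Vilenkin

theorem statement19 (p : ℝ) (hp1 : 0 < p) (hp2 : p < 1 / 2) (lam : ℕ) :
    ∃ c : ℝ, 0 < c ∧ ∀ (m : ℕ → ℕ), (∀ k, 2 ≤ m k) → (∀ k, m k ≤ lam) →
      ∀ (μ : Measure (G m)), IsVilenkinMeasure m μ →
      ∀ n : ℕ, 1 ≤ lo m n → lo m n < hi m n →
      ENNReal.ofReal (c * ((M m (hi m n) : ℝ) / (M m (lo m n) : ℝ)) ^ (1 - 2 * p)) ≤
        ⨆ (t : ℝ) (_ : 0 < t), ENNReal.ofReal t ^ p *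
          μ {x : G m | t < norm (sigma m μ
              (fun y => ((((M m (hi m n) : ℝ) ^ (1 / p - 1) : ℝ)) : ℂ) *
                (D m (M m (hi m n + 1)) y - D m (M m (hi m n)) y)) n x)} := by
  set L : ℝ := lam + 1 with hL
  have hL0 : 0 < L := by positivity
  refine ⟨(8 * L ^ 3) ^ (-p) * L⁻¹, by positivity, ?_⟩
  intro m hm hlam μ hμ n hlo hlt
  have hmL : ∀ k, (m k : ℝ) ≤ L := by
    intro k
    have : (m k : ℝ) ≤ lam := by exact_mod_cast hlam k
    linarith
  obtain ⟨A, hn, hA⟩ := exists_eq_M_hi_add hm hlt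
  have hnlt := (digit_hi_ne_zero hm ((Nat.zero_le _).trans_lt hlt)).2
  obtain ⟨u, hu⟩ : ∃ u, lo m n = u + 1 := ⟨lo m n - 1, by lia⟩
  rw [hu] at hn hA ⊢
  generalize hi m n = N at *
  have ha0 : (0 : ℝ) < M m u := by exact_mod_cast M_pos hm u
  have hs0 : (0 : ℝ) < M m (u + 1) := by exact_mod_cast M_pos hm (u + 1)
  have hR0 : (0 : ℝ) < M m N := by exact_mod_cast M_pos hm N
  have hsL : (M m (u + 1) : ℝ) ≤ L * M m u := by
    rw [M_succ]
    push_cast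
    gcongr
    exact hmL u
  have hs2L : (M m (u + 2) : ℝ) ≤ L * M m (u + 1) := by
    rw [M_succ (u + 1)]
    push_cast
    gcongr
    exact hmL _
  have hnL : (n : ℝ) ≤ L * M m N := by
    have h1 : (n : ℝ) ≤ m N * M m N := by exact_mod_cast hnlt.le
    have h2 := mul_le_mul_of_nonneg_right (hmL N) hR0.le
    linarith
  have hn0 : (0 : ℝ) < n := by
    have : 0 < n := by
      have := M_pos hm N
      lia
    exact_mod_cast this
  set C : ℝ := (M m N : ℝ) ^ (1 / p - 1) with hC
  have hC0 : 0 < C := by positivity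
  set t : ℝ := C * (M m (u + 1) : ℝ) ^ 2 / (8 * L ^ 3 * M m N) with ht
  have ht0 : 0 < t := by positivity
  have hsub : cyl m (u + 2) (e m u + e m (u + 1)) ⊆ {x : G m | t < norm (sigma m μ
      (fun y => (C : ℂ) * (D m (M m (N + 1)) y - D m (M m N) y)) n x)} := by
    intro x hx
    have : Fact (1 < m u) := ⟨hm u⟩
    have hxu : x u = 1 := by simp [hx u (by lia), e]
    have hxs : x (u + 1) = 1 := by simp [hx (u + 1) (by lia), e]
    have hx0 : x ∈ cyl m u 0 := by
      intro j hj
      simp [hx j (by lia), e, show j ≠ u by lia, show j ≠ u + 1 by lia]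
    have key := norm_sum_D_ge hm hA hx0 (by rw [hxu]; exact one_ne_zero) hxs
    have hsig := norm_sigma_D_sub_D hm hμ (C : ℂ) (hn ▸ hnlt.le) x
    rw [← hn, Complex.norm_real, Real.norm_of_nonneg hC0.le] at hsig
    rw [Set.mem_ofPred_eq, hsig]
    set X := ‖∑ i ∈ range (A * M m (u + 1)), D m i x‖
    have hX0 : 0 ≤ X := norm_nonneg _
    have hX : (M m (u + 1) : ℝ) ^ 2 ≤ 4 * L ^ 2 * X := by
      calc (M m (u + 1) : ℝ) ^ 2 ≤ L * M m u * M m (u + 1) := by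
            rw [sq]
            gcongr
        _ = L * (M m u * M m (u + 1)) := by ring
        _ ≤ L * (4 * L * X) := by
            refine mul_le_mul_of_nonneg_left (key.trans ?_) hL0.le
            gcongr
            exact hmL _
        _ = 4 * L ^ 2 * X := by ring
    have hXpos : 0 < X := by
      have : 0 < 4 * L ^ 2 * X := lt_of_lt_of_le (by positivity) hX
      exact pos_of_mul_pos_right this (by positivity)
    calc t ≤ C * (4 * L ^ 2 * X) / (8 * L ^ 3 * M m N) := by
          rw [ht]
          gcongr
      _ = C * X / (2 * (L * M m N)) := by
          field_simp
          ring
      _ < C * X / (L * M m N) := by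
          have : 0 < L * M m N := by positivity
          exact div_lt_div_of_pos_left (by positivity) this (by linarith)
      _ ≤ C * X / n := by gcongr
  refine le_trans ?_ (le_iSup₂_of_le t ht0 le_rfl)
  refine le_trans ?_ (mul_le_mul_right (measure_mono hsub) _)
  have hs20 : (0 : ℝ) < M m (u + 2) := by exact_mod_cast M_pos hm (u + 2)
  rw [hμ.2, ENNReal.ofReal_rpow_of_pos ht0, ← ENNReal.ofReal_natCast,
    ← ENNReal.ofReal_inv_of_pos hs20, ← ENNReal.ofReal_mul (by positivity)]
  refine ENNReal.ofReal_le_ofReal ?_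
  calc (8 * L ^ 3) ^ (-p) * L⁻¹ * ((M m N : ℝ) / (M m (u + 1) : ℝ)) ^ (1 - 2 * p)
      = t ^ p * (L * M m (u + 1))⁻¹ := by
        rw [mul_inv, mul_left_comm, ht, hC, rpow_mul_inv_eq hp1 hR0 hs0 (by positivity)]
        ring
    _ ≤ t ^ p * (M m (u + 2) : ℝ)⁻¹ := by gcongr
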